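/- arXiv:2506.11355 — 2 statements merged into one kernel-verified Lean document; each statement's English description precedes it below -/
import Mathlib

section
/- There exists n₀ such that for all n ≥ n₀ the following holds with N := ⌊2^{10^{-10}·n}⌋. Let C = (c¹, …, c^N) ∈ ({0,1,2,3}^n)^N be such that v_C := N^{−1/2}·Σ_{s=1}^N ψ_{c^s} satisfies |‖v_C‖² − 1| ≤ 2^{−n/10}, and set ψ_C := v_C/‖v_C‖. Then for every orthonormal basis (φ_x)_{x ∈ {0,1}^n} of ℂ^({0,1}^n): (1/2)·Σ_{x ∈ {0,1}^n} | |⟨φ_x, ψ_C⟩|² − (1/N)·Σ_{s=1}^N |⟨φ_x, ψ_{c^s}⟩|² | ≤ (1/N)·Σ_{x ∈ {0,1}^n} | Σ_{s ≠ t} ⟨φ_x, ψ_{c^s}⟩·conj(⟨φ_x, ψ_{c^t}⟩) | + 2^{−0.0001·n}. (The left-hand side is the total variation distance between the outcome distributions of measuring ψ_C and measuring the mixed state ρ_C = (1/N)·Σ_s ψ_{c^s}ψ_{c^s}† in the basis (φ_x).) -/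
open ComplexConjugate

/-- The four SIC-POVM qubit states. -/
noncomputable def chi : Fin 4 → Fin 2 → ℂ
  | 0 => ![1, 0]
  | 1 => ![(Real.sqrt 3 : ℂ)⁻¹, (Real.sqrt (2 / 3) : ℂ)]
  | 2 => ![(Real.sqrt 3 : ℂ)⁻¹,
      (Real.sqrt (2 / 3) : ℂ) * Complex.exp (2 * (Real.pi : ℂ) * Complex.I / 3)]
  | 3 => ![(Real.sqrt 3 : ℂ)⁻¹,
      (Real.sqrt (2 / 3) : ℂ) * Complex.exp (4 * (Real.pi : ℂ) * Complex.I / 3)]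

/-- The SIC product state ψ_c for c ∈ {0,1,2,3}^n. -/
noncomputable def sicProd (n : ℕ) (c : Fin n → Fin 4) : (Fin n → Fin 2) → ℂ :=
  fun x => ∏ i, chi (c i) (x i)

/-- The (unnormalized) superposition v_C = N^{-1/2}·Σ_s ψ_{c^s}. -/
noncomputable def vC (n N : ℕ) (C : Fin N → Fin n → Fin 4) : (Fin n → Fin 2) → ℂ :=
  fun x => ((Real.sqrt N : ℂ))⁻¹ * ∑ s, sicProd n (C s) x

/-- ‖v_C‖². -/
noncomputable def vCnormSq (n N : ℕ) (C : Fin N → Fin n → Fin 4) : ℝ :=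
  ∑ x, ‖vC n N C x‖ ^ 2

/-- The normalized state ψ_C = v_C / ‖v_C‖. -/
noncomputable def psiC (n N : ℕ) (C : Fin N → Fin n → Fin 4) : (Fin n → Fin 2) → ℂ :=
  fun x => ((Real.sqrt (vCnormSq n N C) : ℂ))⁻¹ * vC n N C x

/-- N = ⌊2^{10⁻¹⁰·n}⌋. -/
noncomputable def NN (n : ℕ) : ℕ := Nat.floor ((2 : ℝ) ^ ((10 : ℝ) ^ (-10 : ℝ) * n))

/-- The Parseval identity for an orthonormal family indexed by the coordinates. -/
lemma sum_norm_sq_inner_of_orthonormal {ι : Type*} [Fintype ι] [DecidableEq ι] (φ : ι → ι → ℂ)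
    (hφ : ∀ x x', ∑ y, conj (φ x y) * φ x' y = if x = x' then 1 else 0) (v : ι → ℂ) :
    ∑ x, ‖∑ y, conj (φ x y) * v y‖ ^ 2 = ∑ y, ‖v y‖ ^ 2 := by
  let U : Matrix ι ι ℂ := Matrix.of fun x y => conj (φ x y)
  have hU : U * U.conjTranspose = 1 := by
    ext x x'
    simp [U, Matrix.mul_apply, Matrix.one_apply, hφ]
  have hU' : U.conjTranspose * U = 1 := mul_eq_one_comm.mp hU
  have hnorm (w : ι → ℂ) : ((∑ y, ‖w y‖ ^ 2 : ℝ) : ℂ) = star w ⬝ᵥ w := by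
    simp [dotProduct, Complex.conj_mul']
  have h : star (U.mulVec v) ⬝ᵥ U.mulVec v = star v ⬝ᵥ v := by
    rw [Matrix.star_mulVec, Matrix.dotProduct_mulVec, Matrix.vecMul_vecMul, hU', Matrix.vecMul_one]
  rw [← hnorm, ← hnorm] at h
  exact_mod_cast h

/-- The squared norm of a sum splits into its diagonal and off-diagonal parts. -/
lemma norm_sum_sq_eq_diag_add_offDiag {ι : Type*} [Fintype ι] [DecidableEq ι] (a : ι → ℂ) :
    ((‖∑ s, a s‖ ^ 2 : ℝ) : ℂ) = ((∑ s, ‖a s‖ ^ 2 : ℝ) : ℂ)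
      + ∑ s, ∑ t, if s ≠ t then a s * conj (a t) else 0 := by
  push_cast
  rw [← Complex.mul_conj', map_sum, Finset.sum_mul_sum, ← Finset.sum_add_distrib]
  refine Finset.sum_congr rfl fun s _ => ?_
  rw [← Complex.mul_conj', ← Finset.add_sum_erase _ _ (Finset.mem_univ s), ← Finset.sum_filter]
  congr 2
  ext t
  simp [eq_comm]

/-- The gap between `‖∑ s, a s‖ ^ 2` and `∑ s, ‖a s‖ ^ 2` is the size of the off-diagonal part. -/
lemma abs_norm_sum_sq_sub_sum_norm_sq {ι : Type*} [Fintype ι] [DecidableEq ι] (a : ι → ℂ) :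
    |‖∑ s, a s‖ ^ 2 - ∑ s, ‖a s‖ ^ 2|
      = ‖∑ s, ∑ t, if s ≠ t then a s * conj (a t) else 0‖ := by
  rw [← sub_eq_iff_eq_add'.mpr (norm_sum_sq_eq_diag_add_offDiag a), ← Complex.ofReal_sub,
    Complex.norm_real, Real.norm_eq_abs]

/-- Normalizing a nonnegative function `q` of total mass `M` moves it by at most `|M - 1|`. -/
lemma sum_abs_inv_mul_sub_le {ι : Type*} [Fintype ι] (q d : ι → ℝ) (hq : ∀ x, 0 ≤ q x)
    (M : ℝ) (hM : ∑ x, q x = M) :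
    ∑ x, |M⁻¹ * q x - d x| ≤ |M - 1| + ∑ x, |q x - d x| := by
  have hM0 : 0 ≤ M := hM ▸ Finset.sum_nonneg fun x _ => hq x
  have hx (x : ι) : |M⁻¹ * q x - d x| ≤ |M⁻¹ - 1| * q x + |q x - d x| := by
    rw [← abs_of_nonneg (hq x), ← abs_mul, abs_of_nonneg (hq x)]
    refine le_of_eq_of_le ?_ (abs_add_le _ _)
    ring_nf
  have hmass : |M⁻¹ - 1| * M ≤ |M - 1| := by
    rcases hM0.eq_or_lt with h | h
    · simp [← h]
    · rw [← abs_of_pos h, ← abs_mul, abs_of_pos h, sub_mul, inv_mul_cancel₀ h.ne', one_mul,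
        abs_sub_comm]
  calc ∑ x, |M⁻¹ * q x - d x| ≤ ∑ x, (|M⁻¹ - 1| * q x + |q x - d x|) :=
        Finset.sum_le_sum fun x _ => hx x
    _ = |M⁻¹ - 1| * M + ∑ x, |q x - d x| := by
        rw [Finset.sum_add_distrib, ← Finset.mul_sum, hM]
    _ ≤ _ := by gcongr

/-- for large n, if ‖v_C‖² is within 2^{−n/10} of 1 then for every
orthonormal basis (φ_x) the total variation distance between measuring ψ_C and measuring
the mixture ρ_C is at most (1/N)·Σ_x |Σ_{s≠t} ⟨φ_x,ψ_{c^s}⟩·conj(⟨φ_x,ψ_{c^t}⟩)| + 2^{−0.0001·n}. -/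
theorem stmt_13 :
    ∃ n₀ : ℕ, ∀ n : ℕ, n₀ ≤ n →
      ∀ C : Fin (NN n) → Fin n → Fin 4,
        |vCnormSq n (NN n) C - 1| ≤ (2 : ℝ) ^ (-((n : ℝ) / 10)) →
        ∀ φ : (Fin n → Fin 2) → (Fin n → Fin 2) → ℂ,
          (∀ x x', ∑ y, conj (φ x y) * φ x' y = if x = x' then 1 else 0) →
          (1 / 2 : ℝ) * ∑ x,
              |‖∑ y, conj (φ x y) * psiC n (NN n) C y‖ ^ 2
                - (1 / (NN n : ℝ)) * ∑ s, ‖∑ y, conj (φ x y) * sicProd n (C s) y‖ ^ 2| ≤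
            (1 / (NN n : ℝ)) * ∑ x,
                ‖∑ s, ∑ t, if s ≠ t then
                    (∑ y, conj (φ x y) * sicProd n (C s) y)
                      * conj (∑ y, conj (φ x y) * sicProd n (C t) y)
                  else 0‖
              + (2 : ℝ) ^ (-(0.0001 : ℝ) * n) := by
  refine ⟨0, fun n _ C hC φ hφ => ?_⟩
  generalize NN n = N at C hC ⊢
  set M := vCnormSq n N C with hMdef
  let a (x : Fin n → Fin 2) (s : Fin N) : ℂ := ∑ y, conj (φ x y) * sicProd n (C s) y
  let q (x : Fin n → Fin 2) : ℝ := ‖∑ y, conj (φ x y) * vC n N C y‖ ^ 2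
  have hM0 : 0 ≤ M := Finset.sum_nonneg fun x _ => by positivity
  have hsum : ∑ x, q x = M := sum_norm_sq_inner_of_orthonormal φ hφ _
  have hq (x) : q x = 1 / (N : ℝ) * ‖∑ s, a x s‖ ^ 2 := by
    have h : ∑ y, conj (φ x y) * vC n N C y = (Real.sqrt N : ℂ)⁻¹ * ∑ s, a x s := by
      simp only [a, vC, Finset.mul_sum]
      rw [Finset.sum_comm]
      refine Finset.sum_congr rfl fun s _ => Finset.sum_congr rfl fun y _ => ?_
      ring
    simp only [q, h]
    rw [norm_mul, mul_pow, norm_inv, Complex.norm_real, Real.norm_eq_abs, inv_pow, sq_abs,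
      Real.sq_sqrt (Nat.cast_nonneg N), one_div]
  have hp (x) : ‖∑ y, conj (φ x y) * psiC n N C y‖ ^ 2 = M⁻¹ * q x := by
    have h : ∑ y, conj (φ x y) * psiC n N C y
        = (Real.sqrt M : ℂ)⁻¹ * ∑ y, conj (φ x y) * vC n N C y := by
      simp only [psiC, Finset.mul_sum, ← hMdef]
      refine Finset.sum_congr rfl fun y _ => ?_
      ring
    rw [h, norm_mul, mul_pow, norm_inv, Complex.norm_real, Real.norm_eq_abs, inv_pow, sq_abs,
      Real.sq_sqrt hM0]
  have hoff (x) : |q x - 1 / (N : ℝ) * ∑ s, ‖a x s‖ ^ 2|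
      = 1 / (N : ℝ) * ‖∑ s, ∑ t, if s ≠ t then a x s * conj (a x t) else 0‖ := by
    rw [hq, ← mul_sub, abs_mul, abs_of_nonneg (by positivity), abs_norm_sum_sq_sub_sum_norm_sq]
  have hmain := sum_abs_inv_mul_sub_le q (fun x => 1 / (N : ℝ) * ∑ s, ‖a x s‖ ^ 2)
    (fun x => by positivity) M hsum
  simp only [hoff, ← Finset.mul_sum] at hmain
  simp only [hp]
  have hexp : (2 : ℝ) ^ (-((n : ℝ) / 10)) ≤ (2 : ℝ) ^ (-(0.0001 : ℝ) * n) := by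
    refine Real.rpow_le_rpow_of_exponent_le one_le_two ?_
    have : (0 : ℝ) ≤ n := Nat.cast_nonneg n
    linarith
  have hpos : 0 ≤ 1 / (N : ℝ) * ∑ x, ‖∑ s, ∑ t, if s ≠ t then a x s * conj (a x t) else 0‖ := by
    positivity
  have habs := abs_nonneg (M - 1)
  change 1 / 2 * ∑ x, |M⁻¹ * q x - 1 / (N : ℝ) * ∑ s, ‖a x s‖ ^ 2|
    ≤ 1 / (N : ℝ) * ∑ x, ‖∑ s, ∑ t, if s ≠ t then a x s * conj (a x t) else 0‖ + _
  linarith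
end

section
/- There exists n₀ such that for all n ≥ n₀ the following holds with N := ⌊2^{10^{-10}·n}⌋. Let c¹, …, c^N ∈ {0,1,2,3}^n have pairwise Hamming distance at least n/10, let v_C := N^{−1/2}·Σ_{s=1}^N ψ_{c^s}, and let ψ_C := v_C/‖v_C‖. Then (1/N)·Σ_{s=1}^N |⟨ψ_C, ψ_{c^s}⟩|² ≤ 2^{−(10^{-10}/2)·n}. (The left-hand side equals ⟨ψ_C, ρ_C ψ_C⟩ for the mixed state ρ_C := (1/N)·Σ_s ψ_{c^s}ψ_{c^s}†, so the target state ψ_C has exponentially small fidelity with ρ_C.) -/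
open ComplexConjugate

lemma exp_two_pi_I_div_three :
    Complex.exp (2 * (Real.pi : ℂ) * Complex.I / 3) = ⟨-(1 / 2), Real.sqrt 3 / 2⟩ := by
  have h : 2 * (Real.pi : ℂ) * Complex.I / 3 = ((Real.pi - Real.pi / 3 : ℝ) : ℂ) * Complex.I := by
    push_cast
    ring
  rw [h, Complex.exp_mul_I, ← Complex.ofReal_cos, ← Complex.ofReal_sin, Real.cos_pi_sub,
    Real.sin_pi_sub, Real.cos_pi_div_three, Real.sin_pi_div_three]
  apply Complex.ext <;> simp

lemma exp_four_pi_I_div_three :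
    Complex.exp (4 * (Real.pi : ℂ) * Complex.I / 3) = ⟨-(1 / 2), -(Real.sqrt 3 / 2)⟩ := by
  have h : 4 * (Real.pi : ℂ) * Complex.I / 3 = ((Real.pi / 3 + Real.pi : ℝ) : ℂ) * Complex.I := by
    push_cast
    ring
  rw [h, Complex.exp_mul_I, ← Complex.ofReal_cos, ← Complex.ofReal_sin, Real.cos_add_pi,
    Real.sin_add_pi, Real.cos_pi_div_three, Real.sin_pi_div_three]
  apply Complex.ext <;> simp

/-- The qubit inner products `⟨χ_a, χ_b⟩`. -/
noncomputable def chiInner (a b : Fin 4) : ℂ := ∑ x, conj (chi a x) * chi b x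

lemma chiInner_self (a : Fin 4) : chiInner a a = 1 := by
  have h3 : Real.sqrt 3 * Real.sqrt 3 = 3 := Real.mul_self_sqrt (by norm_num)
  have h2 : Real.sqrt (2 / 3) * Real.sqrt (2 / 3) = 2 / 3 := Real.mul_self_sqrt (by norm_num)
  have h3i : (Real.sqrt 3)⁻¹ * (Real.sqrt 3)⁻¹ = 1 / 3 := by rw [← mul_inv, h3]; norm_num
  fin_cases a <;> apply Complex.ext <;>
    simp [chiInner, chi, exp_two_pi_I_div_three, exp_four_pi_I_div_three, -Complex.ofReal_inv,
      ← Complex.ofReal_inv, -Real.sqrt_div'] <;>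
    grind

lemma norm_chiInner_of_ne {a b : Fin 4} (hab : a ≠ b) : ‖chiInner a b‖ ^ 2 = 1 / 3 := by
  have h3 : Real.sqrt 3 * Real.sqrt 3 = 3 := Real.mul_self_sqrt (by norm_num)
  have h2 : Real.sqrt (2 / 3) * Real.sqrt (2 / 3) = 2 / 3 := Real.mul_self_sqrt (by norm_num)
  have h3i : (Real.sqrt 3)⁻¹ * (Real.sqrt 3)⁻¹ = 1 / 3 := by rw [← mul_inv, h3]; norm_num
  rw [Complex.sq_norm, Complex.normSq_apply]
  fin_cases a <;> fin_cases b <;> first | exact absurd rfl hab | skip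
  all_goals
    simp [chiInner, chi, exp_two_pi_I_div_three, exp_four_pi_I_div_three, -Complex.ofReal_inv,
      ← Complex.ofReal_inv, -Real.sqrt_div']
  all_goals grind

lemma inner_sicProd (n : ℕ) (c d : Fin n → Fin 4) :
    ∑ y, conj (sicProd n c y) * sicProd n d y = ∏ i, chiInner (c i) (d i) := by
  simp only [chiInner, Finset.prod_univ_sum, Fintype.piFinset_univ, sicProd, map_prod,
    Finset.prod_mul_distrib]

lemma inner_sicProd_self (n : ℕ) (c : Fin n → Fin 4) :
    ∑ y, conj (sicProd n c y) * sicProd n c y = 1 := by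
  simp [inner_sicProd, chiInner_self]

lemma norm_inner_sicProd_sq (n : ℕ) (c d : Fin n → Fin 4) :
    ‖∑ y, conj (sicProd n c y) * sicProd n d y‖ ^ 2 =
      (1 / 3 : ℝ) ^ (Finset.univ.filter fun i => c i ≠ d i).card := by
  rw [inner_sicProd, norm_prod, ← Finset.prod_pow, Finset.card_filter, ← Finset.prod_pow_eq_pow_sum]
  refine Finset.prod_congr rfl fun i _ => ?_
  by_cases h : c i = d i
  · simp [h, chiInner_self]
  · simp [h, norm_chiInner_of_ne h]

/-- Codewords at relative distance `1/10` have exponentially small overlap. -/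
lemma norm_inner_sicProd_le (n : ℕ) (c d : Fin n → Fin 4)
    (h : (n : ℝ) / 10 ≤ ((Finset.univ.filter fun i => c i ≠ d i).card : ℝ)) :
    ‖∑ y, conj (sicProd n c y) * sicProd n d y‖ ≤ (2 : ℝ) ^ (-(n / 20 : ℝ)) := by
  refine (sq_le_sq₀ (norm_nonneg _) (by positivity)).1 ?_
  rw [norm_inner_sicProd_sq, ← Real.rpow_natCast, ← Real.rpow_mul_natCast (by norm_num)]
  calc (1 / 3 : ℝ) ^ ((Finset.univ.filter fun i => c i ≠ d i).card : ℝ)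
      ≤ (1 / 3 : ℝ) ^ ((n : ℝ) / 10) :=
        Real.rpow_le_rpow_of_exponent_ge (by norm_num) (by norm_num) h
    _ ≤ (1 / 2 : ℝ) ^ ((n : ℝ) / 10) :=
        Real.rpow_le_rpow (by norm_num) (by norm_num) (by positivity)
    _ = (2 : ℝ) ^ (-(n / 20 : ℝ) * (2 : ℕ)) := by
        rw [one_div, Real.inv_rpow (by norm_num), ← Real.rpow_neg (by norm_num)]
        congr 1
        push_cast
        ring

/-- If unit vectors have pairwise overlaps at most `ε` with `N * ε ≤ 1 / 2`, then the overlap of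
each of them with the sum of all of them is within `1 / 2` of `1`. -/
lemma norm_inner_sum_sub_one_le {ι : Type*} [Fintype ι] {N : ℕ} (u : Fin N → ι → ℂ) {ε : ℝ}
    (hε : 0 ≤ ε) (hN : N * ε ≤ 1 / 2) (h1 : ∀ s, ∑ y, conj (u s y) * u s y = 1)
    (h2 : ∀ s t, s ≠ t → ‖∑ y, conj (u s y) * u t y‖ ≤ ε) (t : Fin N) :
    ‖∑ y, conj (∑ s, u s y) * u t y - 1‖ ≤ 1 / 2 := by
  have h : ∑ y, conj (∑ s, u s y) * u t y = ∑ s, ∑ y, conj (u s y) * u t y := by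
    rw [Finset.sum_comm]
    simp only [map_sum, Finset.sum_mul]
  rw [h, ← Finset.add_sum_erase _ _ (Finset.mem_univ t), h1, add_sub_cancel_left]
  calc ‖∑ s ∈ Finset.univ.erase t, ∑ y, conj (u s y) * u t y‖
      ≤ ∑ _s ∈ Finset.univ.erase t, ε :=
        norm_sum_le_of_le _ fun s hs => h2 s t (Finset.ne_of_mem_erase hs)
    _ ≤ ∑ _s : Fin N, ε :=
        Finset.sum_le_sum_of_subset_of_nonneg (Finset.erase_subset _ _) fun _ _ _ => hε
    _ ≤ 1 / 2 := by simpa using hN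

/-- Under the same hypotheses the squared norm of the sum is at least `N / 2`. -/
lemma half_le_norm_sum_sq {ι : Type*} [Fintype ι] {N : ℕ} (u : Fin N → ι → ℂ)
    (h : ∀ t, ‖∑ y, conj (∑ s, u s y) * u t y - 1‖ ≤ 1 / 2) :
    (N : ℝ) / 2 ≤ ∑ y, ‖∑ s, u s y‖ ^ 2 := by
  have key : ∑ y, ‖∑ s, u s y‖ ^ 2 = ∑ t, (∑ y, conj (∑ s, u s y) * u t y).re := by
    rw [← Complex.re_sum, Finset.sum_comm, Complex.re_sum]
    refine Finset.sum_congr rfl fun y _ => ?_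
    rw [← Finset.mul_sum, Complex.conj_mul', ← Complex.ofReal_pow, Complex.ofReal_re]
  rw [key]
  calc (N : ℝ) / 2 = ∑ _t : Fin N, (1 / 2 : ℝ) := by simp [div_eq_mul_inv]
    _ ≤ _ := Finset.sum_le_sum fun t _ => by
      have := (abs_le.1 ((Complex.abs_re_le_norm _).trans (h t))).1
      rw [Complex.sub_re, Complex.one_re] at this
      linarith

lemma vCnormSq_eq (n N : ℕ) (C : Fin N → Fin n → Fin 4) :
    vCnormSq n N C = (N : ℝ)⁻¹ * ∑ y, ‖∑ s, sicProd n (C s) y‖ ^ 2 := by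
  simp only [vCnormSq, vC, norm_mul, mul_pow, ← Finset.mul_sum, norm_inv, inv_pow,
    Complex.norm_real, Real.norm_eq_abs, sq_abs, Real.sq_sqrt (Nat.cast_nonneg N)]

lemma norm_inner_psiC_sq (n N : ℕ) (hN : 0 < N) (C : Fin N → Fin n → Fin 4) (t : Fin N) :
    ‖∑ y, conj (psiC n N C y) * sicProd n (C t) y‖ ^ 2 =
      ‖∑ y, conj (∑ s, sicProd n (C s) y) * sicProd n (C t) y‖ ^ 2 /
        ∑ y, ‖∑ s, sicProd n (C s) y‖ ^ 2 := by
  have hN' : (N : ℝ) ≠ 0 := by positivity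
  have hV : 0 ≤ vCnormSq n N C := Finset.sum_nonneg fun _ _ => by positivity
  have h : ∑ y, conj (psiC n N C y) * sicProd n (C t) y =
      ((Real.sqrt (vCnormSq n N C) : ℂ))⁻¹ * ((Real.sqrt N : ℂ))⁻¹ *
        ∑ y, conj (∑ s, sicProd n (C s) y) * sicProd n (C t) y := by
    rw [Finset.mul_sum]
    refine Finset.sum_congr rfl fun y _ => ?_
    simp only [psiC, vC, map_mul, map_inv₀, Complex.conj_ofReal]
    ring
  rw [h]
  simp only [norm_mul, mul_pow, norm_inv, inv_pow, Complex.norm_real, Real.norm_eq_abs, sq_abs,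
    Real.sq_sqrt (Nat.cast_nonneg N), Real.sq_sqrt hV]
  rw [vCnormSq_eq, mul_inv, inv_inv, div_eq_mul_inv]
  field_simp

/-- Almost orthogonal codeword states give fidelity `O(1 / N)`. -/
lemma fidelity_le (n N : ℕ) (hN : 0 < N) (C : Fin N → Fin n → Fin 4) {ε : ℝ} (hε : 0 ≤ ε)
    (hNε : N * ε ≤ 1 / 2)
    (h : ∀ s t, s ≠ t → ‖∑ y, conj (sicProd n (C s) y) * sicProd n (C t) y‖ ≤ ε) :
    (1 / (N : ℝ)) * ∑ s, ‖∑ y, conj (psiC n N C y) * sicProd n (C s) y‖ ^ 2 ≤ 9 / 2 / N := by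
  have hN' : (0 : ℝ) < N := by positivity
  have hA := norm_inner_sum_sub_one_le (fun s => sicProd n (C s)) hε hNε
    (fun s => inner_sicProd_self n (C s)) h
  have hW := half_le_norm_sum_sq _ hA
  have hterm : ∀ s, ‖∑ y, conj (psiC n N C y) * sicProd n (C s) y‖ ^ 2 ≤ 9 / 2 / N := fun t => by
    rw [norm_inner_psiC_sq n N hN]
    have hle : ‖∑ y, conj (∑ s, sicProd n (C s) y) * sicProd n (C t) y‖ ≤ 3 / 2 := by
      have h1 := norm_sub_norm_le (∑ y, conj (∑ s, sicProd n (C s) y) * sicProd n (C t) y) 1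
      have h2 := hA t
      rw [norm_one] at h1
      linarith
    calc _ ≤ (3 / 2 : ℝ) ^ 2 / (N / 2) := by gcongr
      _ = 9 / 2 / N := by field_simp; norm_num
  calc _ ≤ (1 / (N : ℝ)) * ∑ _s : Fin N, 9 / 2 / (N : ℝ) := by gcongr with s; exact hterm s
    _ = 9 / 2 / N := by
      simp only [Finset.sum_const, Finset.card_univ, Fintype.card_fin, nsmul_eq_mul]
      field_simp

/-- for all large n, if the codewords c¹,…,c^N have pairwise Hamming
distance at least n/10, then ⟨ψ_C, ρ_C ψ_C⟩ = (1/N)·Σ_s |⟨ψ_C,ψ_{c^s}⟩|² ≤ 2^{−(10⁻¹⁰/2)·n}. -/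
theorem stmt_16 :
    ∃ n₀ : ℕ, ∀ n : ℕ, n₀ ≤ n →
      ∀ C : Fin (NN n) → Fin n → Fin 4,
        (∀ s t : Fin (NN n), s ≠ t →
          (n : ℝ) / 10 ≤ ((Finset.univ.filter fun i => C s i ≠ C t i).card : ℝ)) →
        (1 / (NN n : ℝ)) * ∑ s, ‖∑ y, conj (psiC n (NN n) C y) * sicProd n (C s) y‖ ^ 2 ≤
          (2 : ℝ) ^ (-(((10 : ℝ) ^ (-10 : ℝ)) / 2) * n) := by
  refine ⟨8 * 10 ^ 10, fun n hn C hC => ?_⟩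
  have hn' : (8 * 10 ^ 10 : ℝ) ≤ n := by exact_mod_cast hn
  have hδ : (10 : ℝ) ^ (-10 : ℝ) = 1 / 10 ^ 10 := by
    rw [Real.rpow_neg (by norm_num), one_div]
    norm_cast
  have hNN : NN n = Nat.floor ((2 : ℝ) ^ ((n : ℝ) / 10 ^ 10)) := by
    rw [NN, hδ, one_div_mul_eq_div]
  set X : ℝ := (2 : ℝ) ^ ((n : ℝ) / 10 ^ 10 / 2) with hX
  have hXX : (2 : ℝ) ^ ((n : ℝ) / 10 ^ 10) = X * X := by
    rw [hX, ← Real.rpow_add (by norm_num), add_halves]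
  have hX16 : 16 ≤ X := by
    calc (16 : ℝ) = (2 : ℝ) ^ ((4 : ℕ) : ℝ) := by rw [Real.rpow_natCast]; norm_num
      _ ≤ X := Real.rpow_le_rpow_of_exponent_le (by norm_num) (by push_cast; linarith)
  have hlow : X * X - 1 < NN n := by rw [hNN, ← hXX]; exact Nat.sub_one_lt_floor _
  have hup : (NN n : ℝ) ≤ (2 : ℝ) ^ ((n : ℝ) / 10 ^ 10) := by
    rw [hNN]; exact Nat.floor_le (by positivity)
  have hpos : (0 : ℝ) < NN n := by nlinarith
  have hNε : (NN n : ℝ) * (2 : ℝ) ^ (-(n / 20 : ℝ)) ≤ 1 / 2 := by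
    calc _ ≤ (2 : ℝ) ^ ((n : ℝ) / 10 ^ 10) * (2 : ℝ) ^ (-(n / 20 : ℝ)) := by gcongr
      _ = (2 : ℝ) ^ ((n : ℝ) / 10 ^ 10 + -(n / 20 : ℝ)) := (Real.rpow_add (by norm_num) _ _).symm
      _ ≤ (2 : ℝ) ^ (-1 : ℝ) :=
        Real.rpow_le_rpow_of_exponent_le (by norm_num) (by linarith)
      _ = 1 / 2 := by rw [Real.rpow_neg_one, one_div]
  refine (fidelity_le n (NN n) (by exact_mod_cast hpos) C (by positivity) hNε
    fun s t hst => norm_inner_sicProd_le n _ _ (hC s t hst)).trans ?_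
  have hR : (2 : ℝ) ^ (-(((10 : ℝ) ^ (-10 : ℝ)) / 2) * n) = 1 / X := by
    rw [hX, one_div, ← Real.rpow_neg (by norm_num), hδ]
    congr 1
    ring
  rw [hR, div_le_div_iff₀ hpos (by linarith)]
  nlinarith
end
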